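/- arXiv:2601.20395 — 6 statements merged into one kernel-verified Lean document; each statement's English description precedes it below -/
import Mathlib

section
/- Let p be a prime, n a positive integer, and let G be a closed subgroup of GL_n(ℤ_p), where ℤ_p is the ring of p-adic integers with its usual topology and GL_n(ℤ_p) carries the induced topology. If G contains a dense subset all of whose elements have finite order, then G contains a solvable subgroup of finite index. -/
theorem exists_one_add_pow_eq {R : Type*} [Ring R] (B : R) (m : ℕ) :
    ∃ S : R, (1 + B) ^ m = 1 + m * B + B * B * S := by
  induction m with
  | zero => exact ⟨0, by simp⟩
  | succ m ih =>
    obtain ⟨S, hS⟩ := ih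
    refine ⟨m + S * (1 + B), ?_⟩
    have hc : (m : R) * B * B = B * B * m := by
      rw [mul_assoc]; exact Nat.cast_commute m (B * B)
    rw [pow_succ, hS]
    push_cast
    simp only [mul_add, add_mul, mul_one, one_mul, hc, mul_assoc]
    abel

namespace PadicInt

variable {p : ℕ} [Fact p.Prime] {n : Type*} [Fintype n] [DecidableEq n]

theorem exists_smul_of_one_add_pow_eq_one {B : Matrix n n ℤ_[p]} {q : ℕ} (hq : q.Prime)
    (h : (1 + B) ^ q = 1) {k : ℕ} (hk : 2 ≤ k)
    (hB : ∃ C : Matrix n n ℤ_[p], B = (p : ℤ_[p]) ^ k • C) :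
    ∃ C : Matrix n n ℤ_[p], B = (p : ℤ_[p]) ^ (k + 1) • C := by
  obtain ⟨C, rfl⟩ := hB
  have hp0 : (p : ℤ_[p]) ≠ 0 := Nat.cast_ne_zero.2 (Fact.out : p.Prime).ne_zero
  obtain ⟨S, hS⟩ := exists_one_add_pow_eq ((p : ℤ_[p]) ^ k • C) q
  have h1 : (q : ℤ_[p]) • C = (p : ℤ_[p]) ^ k • (-(C * C * S)) := by
    apply smul_right_injective _ (pow_ne_zero k hp0)
    rw [h, add_assoc, left_eq_add, ← nsmul_eq_mul, ← Nat.cast_smul_eq_nsmul ℤ_[p]] at hS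
    simp only [Matrix.smul_mul, Matrix.mul_smul] at hS
    simp only [smul_neg]
    rw [smul_comm]
    exact eq_neg_of_add_eq_zero_left hS
  obtain ⟨j, rfl⟩ := Nat.exists_eq_add_of_le' hk
  by_cases hqp : q = p
  · subst hqp
    refine ⟨(q : ℤ_[q]) ^ j • (-(C * C * S)), ?_⟩
    rw [pow_succ, mul_smul, h1, smul_smul, smul_smul]
    congr 1
    ring
  · have hcop : IsCoprime (q : ℤ_[p]) (p : ℤ_[p]) :=
      Nat.Coprime.cast ((Nat.coprime_primes hq Fact.out).2 hqp)
    obtain ⟨u, v, huv⟩ := hcop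
    refine ⟨(u * (p : ℤ_[p]) ^ (j + 1)) • (-(C * C * S)) + v • C, ?_⟩
    have hC : C = (u * (p : ℤ_[p]) ^ (j + 2)) • (-(C * C * S)) + (v * p) • C := by
      rw [mul_smul, ← h1, smul_smul, ← add_smul, huv, one_smul]
    conv_lhs => rw [hC]
    simp only [smul_add, smul_smul]
    congr 2 <;> ring

theorem eq_zero_of_one_add_pow_prime_eq_one {B : Matrix n n ℤ_[p]} {q : ℕ} (hq : q.Prime)
    (h : (1 + B) ^ q = 1) (hB : ∃ C : Matrix n n ℤ_[p], B = (p : ℤ_[p]) ^ 2 • C) : B = 0 := by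
  have key : ∀ k, ∃ C : Matrix n n ℤ_[p], B = (p : ℤ_[p]) ^ (k + 2) • C := by
    intro k
    induction k with
    | zero => exact hB
    | succ k ih => exact exists_smul_of_one_add_pow_eq_one hq h (by omega) ih
  ext i j
  by_contra hne
  obtain ⟨k, hk⟩ := FiniteMultiplicity.of_prime_left (prime_p (p := p)) hne
  obtain ⟨C, hC⟩ := key k
  refine hk (dvd_trans (pow_dvd_pow _ (by omega : k + 1 ≤ k + 2)) ⟨C i j, ?_⟩)
  simpa using congrFun (congrFun hC i) j

variable (p n) in
/-- The principal congruence subgroup of level `p ^ k` in `GL n ℤ_[p]`. -/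
noncomputable def congruenceSubgroup (k : ℕ) : Subgroup (GL n ℤ_[p]) :=
  (Matrix.GeneralLinearGroup.map (n := n) (toZModPow (p := p) k)).ker

theorem mem_congruenceSubgroup_iff {k : ℕ} {x : GL n ℤ_[p]} :
    x ∈ congruenceSubgroup p n k ↔
      ∀ i j, ‖(x : Matrix n n ℤ_[p]) i j - (1 : Matrix n n ℤ_[p]) i j‖ ≤ (p : ℝ) ^ (-k : ℤ) := by
  simp only [norm_le_pow_iff_mem_span_pow, ← ker_toZModPow, RingHom.mem_ker, map_sub, sub_eq_zero]
  rw [congruenceSubgroup, MonoidHom.mem_ker, Units.ext_iff, ← Matrix.ext_iff]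
  refine forall_congr' fun i => forall_congr' fun j => ?_
  have h1 : toZModPow k ((1 : Matrix n n ℤ_[p]) i j) = (1 : Matrix n n (ZMod (p ^ k))) i j := by
    rw [Matrix.one_apply, Matrix.one_apply, apply_ite (toZModPow k), map_one, map_zero]
  rw [h1]
  rfl

theorem exists_sub_one_eq_smul_of_mem_congruenceSubgroup {k : ℕ} {x : GL n ℤ_[p]}
    (hx : x ∈ congruenceSubgroup p n k) :
    ∃ C : Matrix n n ℤ_[p], (x : Matrix n n ℤ_[p]) - 1 = (p : ℤ_[p]) ^ k • C := by
  simp only [mem_congruenceSubgroup_iff, norm_le_pow_iff_mem_span_pow,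
    Ideal.mem_span_singleton] at hx
  choose C hC using hx
  exact ⟨Matrix.of C, by ext i j; simpa using hC i j⟩

theorem isOpen_congruenceSubgroup (k : ℕ) :
    IsOpen (congruenceSubgroup p n k : Set (GL n ℤ_[p])) := by
  have hp : (p : ℝ) ^ (-k : ℤ) ≠ 0 :=
    zpow_ne_zero _ (Nat.cast_ne_zero.2 (Fact.out : p.Prime).ne_zero)
  have h : (congruenceSubgroup p n k : Set (GL n ℤ_[p])) = ⋂ i, ⋂ j,
      (fun x : GL n ℤ_[p] => (x : Matrix n n ℤ_[p]) i j) ⁻¹'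
        Metric.closedBall ((1 : Matrix n n ℤ_[p]) i j) ((p : ℝ) ^ (-k : ℤ)) := by
    ext x
    simp [mem_congruenceSubgroup_iff, dist_eq_norm]
  rw [h]
  refine isOpen_iInter_of_finite fun i => isOpen_iInter_of_finite fun j =>
    (IsUltrametricDist.isOpen_closedBall _ hp).preimage ?_
  exact Units.continuous_val.matrix_elem i j

theorem finiteIndex_congruenceSubgroup (k : ℕ) : (congruenceSubgroup p n k).FiniteIndex := by
  have : NeZero (p ^ k) := ⟨pow_ne_zero k (Fact.out : p.Prime).ne_zero⟩
  unfold congruenceSubgroup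
  infer_instance

theorem eq_one_of_mem_congruenceSubgroup_two {x : GL n ℤ_[p]}
    (hx : x ∈ congruenceSubgroup p n 2) (hfin : IsOfFinOrder x) : x = 1 := by
  by_contra hne
  obtain ⟨q, hq, hdvd⟩ := Nat.exists_prime_and_dvd (mt orderOf_eq_one_iff.1 hne)
  obtain ⟨m, hm⟩ := hdvd
  have hm0 : 0 < m := Nat.pos_of_ne_zero fun h => hfin.orderOf_pos.ne' (by simp [hm, h])
  have hyq : (x ^ m) ^ q = 1 := by rw [← pow_mul, mul_comm, ← hm, pow_orderOf_eq_one]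
  have hy1 : x ^ m = 1 := by
    have h := eq_zero_of_one_add_pow_prime_eq_one (B := ((x ^ m : GL n ℤ_[p]) : Matrix n n ℤ_[p]) - 1) hq
      (by rw [add_sub_cancel, ← Units.val_pow_eq_pow_val, hyq, Units.val_one])
      (exists_sub_one_eq_smul_of_mem_congruenceSubgroup (pow_mem hx m))
    exact Units.ext (sub_eq_zero.1 h)
  have hle := Nat.le_of_dvd hm0 (orderOf_dvd_of_pow_eq_one hy1)
  rw [hm] at hle
  nlinarith [hq.two_le]

end PadicInt

/-- Let `p` be a prime and `G` a closed subgroup of `GL n ℤ_[p]`.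
If `G` contains a dense subset of torsion elements, then `G` contains a solvable
subgroup of finite index. -/
theorem stmt_1 (p : ℕ) [Fact p.Prime] (n : ℕ) (hn : 0 < n)
    (G : Subgroup (GL (Fin n) ℤ_[p])) (hGclosed : IsClosed (G : Set (GL (Fin n) ℤ_[p])))
    (D : Set G) (hDdense : Dense D) (hDtor : ∀ x ∈ D, IsOfFinOrder (x : GL (Fin n) ℤ_[p])) :
    ∃ K : Subgroup G, K.FiniteIndex ∧ IsSolvable K := by
  set U := PadicInt.congruenceSubgroup p (Fin n) 2
  have : U.FiniteIndex := PadicInt.finiteIndex_congruenceSubgroup 2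
  have hbot : U.subgroupOf G = ⊥ := by
    rw [Subgroup.eq_bot_iff_forall]
    intro x hx
    by_contra hne
    have hopen : IsOpen ((Subtype.val ⁻¹' (U : Set (GL (Fin n) ℤ_[p]))) ∩ {1}ᶜ : Set G) :=
      ((PadicInt.isOpen_congruenceSubgroup 2).preimage continuous_subtype_val).inter
        isOpen_compl_singleton
    obtain ⟨y, ⟨hyU, hy1⟩, hyD⟩ := hDdense.inter_open_nonempty _ hopen ⟨x, hx, hne⟩
    exact hy1 (Subtype.ext (PadicInt.eq_one_of_mem_congruenceSubgroup_two hyU (hDtor y hyD)))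
  refine ⟨U.subgroupOf G, inferInstance, ?_⟩
  rw [hbot]
  exact (inferInstance : Group.IsSolvable (⊥ : Subgroup G))
end

section
/- Let F be a field and let n and m be positive integers. Then the set of characteristic polynomials of n×n matrices x over F satisfying x^m = 1 is finite; that is, {charpoly(x) : x ∈ M_n(F), x^m = 1} is a finite set of polynomials in F[X]. -/
open Polynomial in
theorem Matrix.pow_eq_one_of_mem_roots_charpoly {K ι : Type*} [Field K] [Fintype ι]
    [DecidableEq ι] {A : Matrix ι ι K} {m : ℕ} (hA : A ^ m = 1) {μ : K}
    (hμ : μ ∈ A.charpoly.roots) : μ ^ m = 1 := by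
  have hspec : μ ∈ spectrum K A :=
    Matrix.mem_spectrum_iff_isRoot_charpoly.mpr (isRoot_of_mem_roots hμ)
  have hpow := spectrum.pow_mem_pow A m hspec
  rw [hA] at hpow
  by_contra hne
  refine hpow ?_
  rw [spectrum.mem_resolventSet_iff, ← map_one (algebraMap K (Matrix ι ι K)), ← map_sub]
  exact (IsUnit.mk0 _ (sub_ne_zero.mpr hne)).map _

open Polynomial in
theorem Matrix.roots_charpoly_le_nsmul_nthRoots {K ι : Type*} [Field K] [Fintype ι]
    [DecidableEq ι] {A : Matrix ι ι K} {m : ℕ} (hm : 0 < m) (hA : A ^ m = 1) :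
    A.charpoly.roots ≤ Fintype.card ι • nthRoots m (1 : K) := by
  classical
  rw [Multiset.le_iff_count]
  intro μ
  by_cases hμ : μ ∈ A.charpoly.roots
  · rw [Multiset.count_nsmul]
    have hpos : 1 ≤ (nthRoots m (1 : K)).count μ :=
      Multiset.one_le_count_iff_mem.mpr
        ((mem_nthRoots hm).mpr (pow_eq_one_of_mem_roots_charpoly hA hμ))
    calc A.charpoly.roots.count μ ≤ A.charpoly.roots.card := Multiset.count_le_card _ _
      _ ≤ A.charpoly.natDegree := card_roots' _
      _ = Fintype.card ι := A.charpoly_natDegree_eq_dim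
      _ ≤ _ := Nat.le_mul_of_pos_right _ hpos
  · simp [Multiset.count_eq_zero_of_notMem hμ]

/-- Over any field `F`, the set of characteristic polynomials of
`n × n` matrices `x` with `x ^ m = 1` is finite. -/
theorem stmt_2 (F : Type*) [Field F] (n m : ℕ) (hn : 0 < n) (hm : 0 < m) :
    {q : Polynomial F | ∃ x : Matrix (Fin n) (Fin n) F, x ^ m = 1 ∧ x.charpoly = q}.Finite := by
  classical
  let φ := algebraMap F (AlgebraicClosure F)
  refine Set.Finite.of_finite_image (f := Polynomial.map φ) ?_
    (Polynomial.map_injective φ φ.injective).injOn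
  refine ((Set.finite_Iic (n • Polynomial.nthRoots m (1 : AlgebraicClosure F))).image
    fun s => (s.map fun a => Polynomial.X - Polynomial.C a).prod).subset ?_
  rintro _ ⟨_, ⟨x, hx, rfl⟩, rfl⟩
  have hxφ : φ.mapMatrix x ^ m = 1 := by rw [← map_pow, hx, map_one]
  rw [← Matrix.charpoly_map]
  refine ⟨(φ.mapMatrix x).charpoly.roots, ?_, ?_⟩
  · simpa using Matrix.roots_charpoly_le_nsmul_nthRoots hm hxφ
  · exact ((IsAlgClosed.splits _).eq_prod_roots_of_monic (Matrix.charpoly_monic _)).symm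
end

section
/- Let R be a commutative ring, let I be an ideal of R with I^k = 0 for some natural number k, and let p be a prime number such that p·1 ∈ I. Then for every positive integer n, the kernel of the reduction homomorphism GL_n(R) → GL_n(R/I) is a p-group, i.e., every invertible n×n matrix over R that is congruent to the identity matrix modulo I has order a power of p. -/
theorem Ideal.mul_mem_matrix_mul {R ι : Type*} [CommRing R] [Fintype ι] [DecidableEq ι]
    {I J : Ideal R} {X Y : Matrix ι ι R} (hX : X ∈ I.matrix ι) (hY : Y ∈ J.matrix ι) :
    X * Y ∈ (I * J).matrix ι := by
  rw [Ideal.mem_matrix] at hX hY ⊢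
  exact fun i j ↦ Ideal.sum_mem _ fun l _ ↦ Ideal.mul_mem_mul (hX i l) (hY l j)

theorem Ideal.mul_mem_matrix_right {R ι : Type*} [CommRing R] [Fintype ι] [DecidableEq ι]
    {I : Ideal R} {X : Matrix ι ι R} (hX : X ∈ I.matrix ι) (Y : Matrix ι ι R) :
    X * Y ∈ I.matrix ι := by
  simpa using Ideal.mul_mem_matrix_mul (J := ⊤) (Y := Y) hX (by simp)

/-- If `p ∈ I`, raising to the `p`-th power sends matrices congruent to `1` modulo `I ^ (m + 1)` to
matrices congruent to `1` modulo `I ^ (m + 2)`. -/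
theorem Ideal.pow_prime_sub_one_mem_matrix {R ι : Type*} [CommRing R] [Fintype ι] [DecidableEq ι]
    {I : Ideal R} {p : ℕ} (hp : p.Prime) (hpI : (p : R) ∈ I) {m : ℕ} {A : Matrix ι ι R}
    (hA : A - 1 ∈ (I ^ (m + 1)).matrix ι) : A ^ p - 1 ∈ (I ^ (m + 2)).matrix ι := by
  obtain ⟨r, hr⟩ := (Commute.one_left (A - 1)).exists_add_pow_prime_eq hp
  rw [add_sub_cancel] at hr
  have hpM : (p : Matrix ι ι R) ∈ I.matrix ι := by
    rw [Ideal.mem_matrix]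
    intro i j
    rw [← Matrix.diagonal_natCast, Matrix.diagonal_apply]
    split_ifs
    exacts [hpI, I.zero_mem]
  have hsq : (A - 1) * (A - 1) ∈ (I ^ (m + 2)).matrix ι := by
    refine Ideal.matrix_monotone ι ?_ (Ideal.mul_mem_matrix_mul hA hA)
    rw [← pow_add]
    exact Ideal.pow_le_pow_right (by lia)
  have hpow : (A - 1) ^ p ∈ (I ^ (m + 2)).matrix ι := by
    rw [← pow_mul_pow_sub (A - 1) hp.two_le, sq (A - 1)]
    exact Ideal.mul_mem_matrix_right hsq _
  have hlin : (p : Matrix ι ι R) * 1 * (A - 1) * r ∈ (I ^ (m + 2)).matrix ι := by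
    rw [mul_one, pow_succ' I (m + 1)]
    exact Ideal.mul_mem_matrix_right (Ideal.mul_mem_matrix_mul hpM hA) r
  rw [hr, one_pow, add_assoc, add_sub_cancel_left]
  exact add_mem hpow hlin

theorem Ideal.pow_prime_pow_sub_one_mem_matrix {R ι : Type*} [CommRing R] [Fintype ι]
    [DecidableEq ι] {I : Ideal R} {p : ℕ} (hp : p.Prime) (hpI : (p : R) ∈ I) {A : Matrix ι ι R}
    (hA : A - 1 ∈ I.matrix ι) (m : ℕ) : A ^ p ^ m - 1 ∈ (I ^ (m + 1)).matrix ι := by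
  induction m with
  | zero => simpa using hA
  | succ m ih =>
    rw [pow_succ p, pow_mul]
    exact Ideal.pow_prime_sub_one_mem_matrix hp hpI ih

/-- Let `R` be a commutative ring, `I` a nilpotent ideal (`I ^ k = 0`)
containing `p · 1` for a prime `p`.  Then the kernel of the reduction homomorphism
`GL n R →* GL n (R ⧸ I)` is a `p`-group. -/
theorem stmt_6 (R : Type*) [CommRing R] (I : Ideal R) (k : ℕ) (hI : I ^ k = 0)
    (p : ℕ) (hp : p.Prime) (hpI : (p : R) ∈ I) (n : ℕ) (hn : 0 < n) :
    IsPGroup p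
      (MonoidHom.ker (Matrix.GeneralLinearGroup.map (n := Fin n) (Ideal.Quotient.mk I))) := by
  rintro ⟨g, hg⟩
  refine ⟨k, Subtype.ext (Units.ext ?_)⟩
  have hmem : (g : Matrix (Fin n) (Fin n) R) - 1 ∈ I.matrix (Fin n) := by
    rw [Ideal.mem_matrix]
    intro i j
    have hij := congrArg (fun u : GL (Fin n) (R ⧸ I) ↦ u i j) (MonoidHom.mem_ker.mp hg)
    rw [← Ideal.Quotient.eq_zero_iff_mem, Matrix.sub_apply, map_sub, sub_eq_zero]
    simpa [Matrix.one_apply, apply_ite] using hij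
  have hpow := Ideal.pow_prime_pow_sub_one_mem_matrix hp hpI hmem k
  rw [pow_succ, hI, zero_mul, Ideal.zero_eq_bot, Ideal.matrix_bot, Ideal.mem_bot,
    sub_eq_zero] at hpow
  simpa using hpow
end

section
/- Let F be a field of positive characteristic p, let n be a positive integer, and let q ≥ 2 be a natural number. Suppose M and N are elements of GL_n(F) satisfying N M N^{-1} = M^q. Then M has finite order. -/
open Polynomial in
/-- If every root of `P` in an algebraic closure is a root of `Q`, then `P` divides every
sufficiently large power of `Q`. -/
theorem Polynomial.dvd_pow_of_forall_isRoot {F : Type*} [Field F] {P Q : F[X]} (hP : P ≠ 0)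
    (hQ : Q ≠ 0)
    (hPQ : ∀ x : AlgebraicClosure F, aeval x P = 0 → aeval x Q = 0) {m : ℕ}
    (hm : P.natDegree ≤ m) : P ∣ Q ^ m := by
  classical
  let φ := algebraMap F (AlgebraicClosure F)
  have hP' : P.map φ ≠ 0 := Polynomial.map_ne_zero hP
  have hQ' : Q.map φ ≠ 0 := Polynomial.map_ne_zero hQ
  rw [← Polynomial.map_dvd_map' φ, Polynomial.map_pow]
  refine (IsAlgClosed.splits (P.map φ)).dvd_of_roots_le_roots hP' ?_
  rw [Multiset.le_iff_count]
  intro x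
  by_cases hx : x ∈ (P.map φ).roots
  · have hxQ : x ∈ (Q.map φ).roots := by
      rw [mem_roots hQ', IsRoot.def, eval_map_algebraMap]
      rw [mem_roots hP', IsRoot.def, eval_map_algebraMap] at hx
      exact hPQ x hx
    rw [roots_pow, Multiset.count_nsmul]
    calc (P.map φ).roots.count x ≤ Multiset.card (P.map φ).roots := Multiset.count_le_card _ _
      _ ≤ (P.map φ).natDegree := card_roots' _
      _ = P.natDegree := natDegree_map φ
      _ ≤ m := hm
      _ ≤ m * (Q.map φ).roots.count x :=
        Nat.le_mul_of_pos_right m (Multiset.count_pos.2 hxQ)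
  · rw [Multiset.count_eq_zero_of_notMem hx]
    exact Nat.zero_le _

/-- A finite set stable under `x ↦ x ^ q` has two distinct iterates of this map that agree on it. -/
theorem Set.Finite.exists_pow_pow_eq {K : Type*} [Monoid K] {S : Set K} (hS : S.Finite) {q : ℕ}
    (hq : ∀ x ∈ S, x ^ q ∈ S) :
    ∃ i j : ℕ, i < j ∧ ∀ x ∈ S, x ^ q ^ i = x ^ q ^ j := by
  have : Finite S := hS
  have hmem : ∀ (i : ℕ), ∀ x ∈ S, x ^ q ^ i ∈ S := by
    intro i
    induction i with
    | zero => simp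
    | succ i ih =>
      intro x hx
      rw [pow_succ, pow_mul]
      exact hq _ (ih x hx)
  let f : ℕ → S → S := fun i x => ⟨(x : K) ^ q ^ i, hmem i x x.2⟩
  obtain ⟨i, j, hij, hf⟩ := Finite.exists_ne_map_eq_of_infinite f
  have key : ∀ x ∈ S, x ^ q ^ i = x ^ q ^ j := fun x hx =>
    congrArg Subtype.val (congrFun hf ⟨x, hx⟩)
  rcases hij.lt_or_gt with hlt | hlt
  · exact ⟨i, j, hlt, key⟩
  · exact ⟨j, i, hlt, fun x hx => (key x hx).symm⟩

open Polynomial in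
/-- Let `F` be a field of positive characteristic `p`, and let
`M, N ∈ GL n F` satisfy `N * M * N⁻¹ = M ^ q` for some natural number `q ≥ 2`.
Then `M` has finite order. -/
theorem stmt_8 (F : Type*) [Field F] (p : ℕ) (hp : 0 < p) [CharP F p]
    (n : ℕ) (hn : 0 < n) (q : ℕ) (hq : 2 ≤ q)
    (M N : GL (Fin n) F) (h : N * M * N⁻¹ = M ^ q) :
    IsOfFinOrder M := by
  have hprime : p.Prime := (CharP.char_is_prime_or_zero F p).resolve_right hp.ne'
  have : Fact p.Prime := ⟨hprime⟩
  let A : Matrix (Fin n) (Fin n) F := M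
  let P : F[X] := minpoly F A
  have hP : P ≠ 0 := minpoly.ne_zero (Matrix.isIntegral A)
  have hconj : A ^ q = MulSemiringAction.toAlgEquiv F (Matrix (Fin n) (Fin n) F)
      (ConjAct.toConjAct N) A := by
    have := congrArg Units.val h
    simpa [ConjAct.units_smul_def, A] using this.symm
  have hexp : P ∣ expand F q P := by
    refine minpoly.dvd F A ?_
    rw [expand_aeval, hconj, aeval_algHom_apply, minpoly.aeval, map_zero]
  obtain ⟨i, j, hij, hroot⟩ := (P.rootSet_finite (AlgebraicClosure F)).exists_pow_pow_eq
    (q := q) fun x hx => by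
      rw [mem_rootSet_of_ne hP] at hx ⊢
      rw [← expand_aeval]
      exact aeval_eq_zero_of_dvd_aeval_eq_zero hexp hx
  have hlt : q ^ i < q ^ j := Nat.pow_lt_pow_right hq hij
  have hQ : (X ^ q ^ j - X ^ q ^ i : F[X]) ≠ 0 := by
    rw [sub_ne_zero]
    intro heq
    have := congrArg natDegree heq
    simp only [natDegree_X_pow] at this
    exact hlt.ne' this
  have hdvd : P ∣ (X ^ q ^ j - X ^ q ^ i : F[X]) ^ p ^ P.natDegree := by
    refine dvd_pow_of_forall_isRoot hP hQ (fun x hx => ?_)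
      (Nat.lt_pow_self hprime.one_lt).le
    simp [hroot x ((mem_rootSet_of_ne hP).2 hx)]
  rw [sub_pow_char_pow, ← pow_mul, ← pow_mul] at hdvd
  have hA := aeval_eq_zero_of_dvd_aeval_eq_zero hdvd (minpoly.aeval F A)
  rw [map_sub, map_pow, map_pow, aeval_X, sub_eq_zero] at hA
  have hM : M ^ (q ^ j * p ^ P.natDegree) = M ^ (q ^ i * p ^ P.natDegree) :=
    Units.ext (by simpa [A] using hA)
  by_contra hfin
  exact (Nat.mul_lt_mul_of_pos_right hlt (pow_pos hp _)).ne'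
    (injective_pow_iff_not_isOfFinOrder.2 hfin hM)
end

section
/- Let p be a prime and H a finite group whose order is not divisible by p, and let R = 𝔽_p[H] be the group algebra of H over the field with p elements. Let M₁, M₂, M₃, M₄, M₅ and N₁ be R-modules that are finite as sets, let f₁ : M₁ → M₂, f₂ : M₂ → M₃, f₃ : M₃ → M₄, f₄ : M₄ → M₅ be R-linear maps forming an exact sequence 0 → M₁ → M₂ → M₃ → M₄ → M₅ → 0 (i.e., f₁ is injective, ker f₂ = im f₁, ker f₃ = im f₂, ker f₄ = im f₃, and f₄ is surjective), and let g : N₁ → M₂ be an injective R-linear map such that the quotient module M₂ / im(g) is R-isomorphic to M₅. Then M₄ is R-isomorphic to the direct sum (M₁ / f₁^{-1}(im g)) ⊕ (M₃ / im(f₂ ∘ g)). -/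
/-- A short exact sequence of modules with semisimple middle term splits. -/
theorem Function.Exact.nonempty_linearEquiv_prod {R A B C : Type*} [Ring R]
    [AddCommGroup A] [AddCommGroup B] [AddCommGroup C] [Module R A] [Module R B] [Module R C]
    [IsSemisimpleModule R B] {f : A →ₗ[R] B} {g : B →ₗ[R] C} (h : Function.Exact f g)
    (hf : Function.Injective f) (hg : Function.Surjective g) : Nonempty (B ≃ₗ[R] A × C) := by
  obtain ⟨l, hl⟩ := IsSemisimpleModule.extension_property f hf LinearMap.id
  exact ⟨(h.splitInjectiveEquiv hg ⟨l, hl⟩).1⟩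

/-- In an exact sequence `0 → A → B → C → D → 0` of modules with `B` and `C` semisimple, the
alternating terms have isomorphic direct sums. -/
theorem Function.Exact.nonempty_prod_linearEquiv_prod {R A B C D : Type*} [Ring R]
    [AddCommGroup A] [AddCommGroup B] [AddCommGroup C] [AddCommGroup D]
    [Module R A] [Module R B] [Module R C] [Module R D]
    [IsSemisimpleModule R B] [IsSemisimpleModule R C]
    {f : A →ₗ[R] B} {g : B →ₗ[R] C} {k : C →ₗ[R] D}
    (hf : Function.Injective f) (hfg : Function.Exact f g) (hgk : Function.Exact g k)
    (hk : Function.Surjective k) : Nonempty ((A × C) ≃ₗ[R] D × B) := by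
  have hfg' : Function.Exact f g.rangeRestrict := fun x ↦ by
    rw [← hfg x, Subtype.ext_iff]; rfl
  have hgk' : Function.Exact (LinearMap.range g).subtype k := fun x ↦ by
    rw [hgk x]; simp
  obtain ⟨e₁⟩ := hfg'.nonempty_linearEquiv_prod hf g.surjective_rangeRestrict
  obtain ⟨e₂⟩ := hgk'.nonempty_linearEquiv_prod (Submodule.subtype_injective _) hk
  exact ⟨(LinearEquiv.refl R A).prodCongr e₂ ≪≫ₗ (LinearEquiv.prodAssoc R A _ D).symm ≪≫ₗ
    e₁.symm.prodCongr (LinearEquiv.refl R D) ≪≫ₗ LinearEquiv.prodComm R B D⟩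


/-- Let `p` be a prime, `H` a finite group with `p ∤ |H|`, and work
over the group algebra `𝔽_p[H]`.  Given finite modules and an exact sequence
`0 → M₁ → M₂ → M₃ → M₄ → M₅ → 0` together with an injection `g : N₁ → M₂` with
`M₂ / im g ≅ M₅`, we have `M₄ ≅ (M₁ / f₁⁻¹(im g)) ⊕ (M₃ / im (f₂ ∘ g))`. -/
theorem stmt_12 (p : ℕ) (hp : p.Prime) (H : Type*) [Group H] [Fintype H]
    (hpH : ¬ p ∣ Fintype.card H)
    (M₁ M₂ M₃ M₄ M₅ N₁ : Type*)
    [AddCommGroup M₁] [AddCommGroup M₂] [AddCommGroup M₃] [AddCommGroup M₄]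
    [AddCommGroup M₅] [AddCommGroup N₁]
    [Module (MonoidAlgebra (ZMod p) H) M₁] [Module (MonoidAlgebra (ZMod p) H) M₂]
    [Module (MonoidAlgebra (ZMod p) H) M₃] [Module (MonoidAlgebra (ZMod p) H) M₄]
    [Module (MonoidAlgebra (ZMod p) H) M₅] [Module (MonoidAlgebra (ZMod p) H) N₁]
    [Finite M₁] [Finite M₂] [Finite M₃] [Finite M₄] [Finite M₅] [Finite N₁]
    (f₁ : M₁ →ₗ[MonoidAlgebra (ZMod p) H] M₂)
    (f₂ : M₂ →ₗ[MonoidAlgebra (ZMod p) H] M₃)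
    (f₃ : M₃ →ₗ[MonoidAlgebra (ZMod p) H] M₄)
    (f₄ : M₄ →ₗ[MonoidAlgebra (ZMod p) H] M₅)
    (hf₁ : Function.Injective f₁)
    (h₁₂ : LinearMap.ker f₂ = LinearMap.range f₁)
    (h₂₃ : LinearMap.ker f₃ = LinearMap.range f₂)
    (h₃₄ : LinearMap.ker f₄ = LinearMap.range f₃)
    (hf₄ : Function.Surjective f₄)
    (g : N₁ →ₗ[MonoidAlgebra (ZMod p) H] M₂)
    (hg : Function.Injective g)
    (hquot : Nonempty ((M₂ ⧸ LinearMap.range g) ≃ₗ[MonoidAlgebra (ZMod p) H] M₅)) :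
    Nonempty (M₄ ≃ₗ[MonoidAlgebra (ZMod p) H]
      ((M₁ ⧸ Submodule.comap f₁ (LinearMap.range g)) ×
        (M₃ ⧸ LinearMap.range (f₂ ∘ₗ g)))) := by
  have : Fact p.Prime := ⟨hp⟩
  have : NeZero (Nat.card H : ZMod p) :=
    ⟨by rwa [Nat.card_eq_fintype_card, Ne, ZMod.natCast_eq_zero_iff]⟩
  have hle : LinearMap.range g ≤ Submodule.comap f₂ (LinearMap.range (f₂ ∘ₗ g)) := by
    rintro _ ⟨n, rfl⟩
    exact ⟨n, rfl⟩
  have hle' : LinearMap.range (f₂ ∘ₗ g) ≤ LinearMap.ker f₃.rangeRestrict := by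
    rw [LinearMap.ker_rangeRestrict, h₂₃]
    exact LinearMap.range_comp_le_range g f₂
  let α := Submodule.mapQ _ (LinearMap.range g) f₁ le_rfl
  let φ := Submodule.mapQ _ _ f₂ hle
  let ψ := Submodule.liftQ _ f₃.rangeRestrict hle'
  have hα : Function.Injective α := by
    rw [← LinearMap.ker_eq_bot, Submodule.ker_mapQ, Submodule.mkQ_map_self]
  have hαφ : Function.Exact α φ := by
    rw [LinearMap.exact_iff, Submodule.ker_mapQ, Submodule.range_mapQ, LinearMap.range_comp,
      Submodule.comap_map_eq, Submodule.map_sup, Submodule.mkQ_map_self, bot_sup_eq, h₁₂]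
  have hφψ : Function.Exact φ ψ := by
    rw [LinearMap.exact_iff, Submodule.ker_liftQ, Submodule.range_mapQ,
      LinearMap.ker_rangeRestrict, h₂₃]
  have hψ : Function.Surjective ψ := by
    rw [← LinearMap.range_eq_top, Submodule.range_liftQ, LinearMap.range_rangeRestrict]
  have h₄ : Function.Exact (LinearMap.range f₃).subtype f₄ := by
    rw [LinearMap.exact_iff, h₃₄, Submodule.range_subtype]
  obtain ⟨e⟩ := hαφ.nonempty_prod_linearEquiv_prod hα hφψ hψ
  obtain ⟨e₄⟩ := h₄.nonempty_linearEquiv_prod (Submodule.subtype_injective _) hf₄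
  obtain ⟨q⟩ := hquot
  exact ⟨e₄ ≪≫ₗ (LinearEquiv.refl _ _).prodCongr q.symm ≪≫ₗ e.symm⟩
end

section
/- Let R be a (not necessarily commutative) ring and let M be an R-module that is finite as a set, semisimple, and multiplicity-free, meaning that any two simple submodules of M that are isomorphic as R-modules are equal. Then the endomorphism ring End_R(M) of R-linear endomorphisms of M is commutative. -/
/-- In a module whose isomorphic simple submodules are equal, every simple submodule is stable
under every endomorphism. -/
theorem Submodule.map_le_self_of_isSimpleModule {R M : Type*} [Ring R] [AddCommGroup M]
    [Module R M]
    (hmf : ∀ S T : Submodule R M, IsSimpleModule R S → IsSimpleModule R T →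
      Nonempty (S ≃ₗ[R] T) → S = T)
    (S : Submodule R M) [IsSimpleModule R S] (f : Module.End R M) : S.map f ≤ S := by
  rcases LinearMap.injective_or_eq_zero (f.domRestrict S) with h | h
  · have e : S ≃ₗ[R] S.map f :=
      (LinearEquiv.ofInjective (f.domRestrict S) h).trans
        (LinearEquiv.ofEq _ _ (LinearMap.range_domRestrict S f))
    exact (hmf S (S.map f) inferInstance (IsSimpleModule.congr e.symm) ⟨e⟩).ge
  · rw [← LinearMap.range_domRestrict, h, LinearMap.range_zero]
    exact bot_le

/-- Endomorphisms of a finite simple module commute, by Schur and Wedderburn. -/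
theorem IsSimpleModule.end_mul_comm {R M : Type*} [Ring R] [AddCommGroup M] [Module R M]
    [Finite M] [IsSimpleModule R M] (f g : Module.End R M) : f * g = g * f := by
  classical
  have : Finite (Module.End R M) := Finite.of_injective _ DFunLike.coe_injective
  have : IsDomain (Module.End R M) := DivisionRing.isDomain
  exact (Finite.isDomain_to_isField (Module.End R M)).mul_comm f g

/-- Let `M` be a finite, semisimple, multiplicity-free module over a
(not necessarily commutative) ring `R` (any two isomorphic simple submodules of `M`
are equal).  Then the endomorphism ring `End_R(M)` is commutative. -/
theorem stmt_13 (R : Type*) [Ring R] (M : Type*) [AddCommGroup M] [Module R M]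
    [Finite M] (hss : IsSemisimpleModule R M)
    (hmf : ∀ S T : Submodule R M, IsSimpleModule R S → IsSimpleModule R T →
      Nonempty (S ≃ₗ[R] T) → S = T) :
    ∀ f g : Module.End R M, f * g = g * f := by
  intro f g
  rw [← LinearMap.eqLocus_eq_top, eq_top_iff, ← IsSemisimpleModule.sSup_simples_eq_top R M]
  refine sSup_le fun S hS x hx => ?_
  have : IsSimpleModule R S := hS
  have stable (k : Module.End R M) : ∀ y ∈ S, k y ∈ S :=
    Submodule.map_le_iff_le_comap.mp (S.map_le_self_of_isSimpleModule hmf k)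
  have comm := IsSimpleModule.end_mul_comm (f.restrict (stable f)) (g.restrict (stable g))
  exact congrArg Subtype.val (LinearMap.congr_fun comm ⟨x, hx⟩)
end
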